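/- Let Φ be a TH system with split sequence {φ_i}_{i=1}^d. Then for 1 ≤ i ≤ d, φ_i is also the eigenvalue of (A* - θ*_i I)(A - θ_{d-i+1} I) on the eigenspace U_{i-1}. -/

import Mathlib

/-- A thin Hessenberg system on `V`: multiplicity-free `A`, `Astar` with
orderings of primitive idempotents `E`, `Estar` (eigenvalues `θ`, `θs`)
satisfying the Hessenberg conditions. -/
structure THSystem (K V : Type*) [Field K] [AddCommGroup V] [Module K V] (d : ℕ) where
  A : Module.End K V
  Astar : Module.End K V
  E : Fin (d + 1) → Module.End K V
  Estar : Fin (d + 1) → Module.End K V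
  θ : Fin (d + 1) → K
  θs : Fin (d + 1) → K
  finrank_eq : Module.finrank K V = d + 1
  θ_inj : Function.Injective θ
  θs_inj : Function.Injective θs
  sum_E : ∑ i, E i = 1
  E_mul : ∀ i j, E i * E j = if i = j then E i else 0
  E_ne : ∀ i, E i ≠ 0
  sum_Es : ∑ i, Estar i = 1
  Es_mul : ∀ i j, Estar i * Estar j = if i = j then Estar i else 0
  Es_ne : ∀ i, Estar i ≠ 0
  A_eq : A = ∑ i, θ i • E i
  As_eq : Astar = ∑ i, θs i • Estar i
  EAsE_zero : ∀ i j : Fin (d + 1), (j : ℕ) + 1 < (i : ℕ) → E i * Astar * E j = 0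
  EAsE_ne : ∀ i j : Fin (d + 1), (i : ℕ) = (j : ℕ) + 1 → E i * Astar * E j ≠ 0
  EsAEs_zero : ∀ i j : Fin (d + 1), (j : ℕ) + 1 < (i : ℕ) → Estar i * A * Estar j = 0
  EsAEs_ne : ∀ i j : Fin (d + 1), (i : ℕ) = (j : ℕ) + 1 → Estar i * A * Estar j ≠ 0
/-- The split decomposition subspaces
`U_i = (Σ_{h ≤ i} E*_h V) ⊓ (Σ_{h ≤ d-i} E_h V)`. -/
def splitU {K V : Type*} [Field K] [AddCommGroup V] [Module K V] {d : ℕ}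
    (Φ : THSystem K V d) (i : Fin (d + 1)) : Submodule K V :=
  (⨆ h : Fin (d + 1), ⨆ _ : (h : ℕ) ≤ (i : ℕ), LinearMap.range (Φ.Estar h)) ⊓
  (⨆ h : Fin (d + 1), ⨆ _ : (h : ℕ) ≤ d - (i : ℕ), LinearMap.range (Φ.E h))
/-- `φ` is the split sequence of `Φ`:
`(A - θ_{d-i+1}) (A* - θ*_i)` acts on `U_i` as `φ_i`, for `1 ≤ i ≤ d`. -/
def IsSplitSeq {K V : Type*} [Field K] [AddCommGroup V] [Module K V] {d : ℕ}
    (Φ : THSystem K V d) (φ : Fin (d + 1) → K) : Prop :=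
  ∀ i : Fin (d + 1), ∀ hi : 1 ≤ (i : ℕ), ∀ u ∈ splitU Φ i,
    (Φ.A - Φ.θ ⟨d - (i : ℕ) + 1, by have := i.isLt; omega⟩ • (1 : Module.End K V))
      ((Φ.Astar - Φ.θs i • (1 : Module.End K V)) u) = φ i • u

section OrthogonalIdempotents

variable {K V : Type*} [Field K] [AddCommGroup V] [Module K V] {d : ℕ}
  {E : Fin (d + 1) → Module.End K V}

lemma orthogonal_idempotents_apply (hE : ∀ i j, E i * E j = if i = j then E i else 0)
    (i j : Fin (d + 1)) (v : V) : E i (E j v) = if i = j then E i v else 0 := by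
  rw [← Module.End.mul_apply, hE]
  split_ifs <;> simp

/-- A family of `dim V` nonzero orthogonal idempotents consists of coordinate projections. -/
lemma exists_basis_of_orthogonal_idempotents (hV : Module.finrank K V = d + 1)
    (hE : ∀ i j, E i * E j = if i = j then E i else 0) (hne : ∀ i, E i ≠ 0) :
    ∃ b : Module.Basis (Fin (d + 1)) K V, ∀ i v, E i v = b.repr v i • b i := by
  have hex : ∀ i, ∃ x, E i x ≠ 0 := fun i => by
    by_contra! h
    exact hne i (LinearMap.ext h)
  choose x hx using hex
  have hli : LinearIndependent K fun i => E i (x i) := by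
    rw [Fintype.linearIndependent_iff]
    intro g hg i
    have h := congrArg (E i) hg
    simpa [map_sum, orthogonal_idempotents_apply hE, hx i] using h
  let b := basisOfLinearIndependentOfCardEqFinrank hli (by simp [hV])
  have hb : ∀ i, b i = E i (x i) := fun i => by simp [b]
  refine ⟨b, fun i v => ?_⟩
  conv_lhs => rw [← b.sum_repr v]
  simp only [map_sum, map_smul, hb, orthogonal_idempotents_apply hE, smul_ite, smul_zero,
    Finset.sum_ite_eq, Finset.mem_univ, if_true]

lemma mem_iSup_range_iff (hE : ∀ i j, E i * E j = if i = j then E i else 0)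
    (hsum : ∑ i, E i = 1) (k : ℕ) (v : V) :
    (v ∈ ⨆ h : Fin (d + 1), ⨆ _ : (h : ℕ) ≤ k, LinearMap.range (E h)) ↔
      ∀ h : Fin (d + 1), k < h → E h v = 0 := by
  constructor
  · intro hv h hk
    have hle : (⨆ h : Fin (d + 1), ⨆ _ : (h : ℕ) ≤ k, LinearMap.range (E h)) ≤
        LinearMap.ker (E h) := by
      refine iSup₂_le fun j hj => ?_
      rintro _ ⟨x, rfl⟩
      have hne : h ≠ j := by rintro rfl; omega
      simp [orthogonal_idempotents_apply hE, hne]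
    exact hle hv
  · intro hv
    have hs : ∑ i, E i v = v := by
      rw [← LinearMap.sum_apply, hsum, Module.End.one_apply]
    rw [← hs]
    refine Submodule.sum_mem _ fun i _ => ?_
    by_cases hi : (i : ℕ) ≤ k
    · exact Submodule.mem_iSup_of_mem i (Submodule.mem_iSup_of_mem hi ⟨v, rfl⟩)
    · rw [hv i (by omega)]
      exact Submodule.zero_mem _

lemma apply_sum_smul_idempotents (hE : ∀ i j, E i * E j = if i = j then E i else 0)
    (c : Fin (d + 1) → K) (i : Fin (d + 1)) (v : V) :
    E i ((∑ j, c j • E j) v) = c i • E i v := by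
  simp [LinearMap.sum_apply, map_sum, orthogonal_idempotents_apply hE]

end OrthogonalIdempotents

namespace THSystem

variable {K V : Type*} [Field K] [AddCommGroup V] [Module K V] {d : ℕ} (Φ : THSystem K V d)

lemma mem_splitU_iff (i : Fin (d + 1)) (v : V) :
    v ∈ splitU Φ i ↔ (∀ h : Fin (d + 1), (i : ℕ) < h → Φ.Estar h v = 0) ∧
      ∀ h : Fin (d + 1), d - (i : ℕ) < h → Φ.E h v = 0 := by
  rw [splitU, Submodule.mem_inf, mem_iSup_range_iff Φ.Es_mul Φ.sum_Es,
    mem_iSup_range_iff Φ.E_mul Φ.sum_E]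

lemma sum_E_apply (v : V) : ∑ i, Φ.E i v = v := by
  rw [← LinearMap.sum_apply, Φ.sum_E, Module.End.one_apply]

lemma sum_Estar_apply (v : V) : ∑ i, Φ.Estar i v = v := by
  rw [← LinearMap.sum_apply, Φ.sum_Es, Module.End.one_apply]

lemma Estar_Astar_apply (i : Fin (d + 1)) (v : V) :
    Φ.Estar i (Φ.Astar v) = Φ.θs i • Φ.Estar i v := by
  rw [Φ.As_eq, apply_sum_smul_idempotents Φ.Es_mul]

lemma E_Astar_E_apply_eq_zero {i j : Fin (d + 1)} (h : (j : ℕ) + 1 < i) (v : V) :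
    Φ.E i (Φ.Astar (Φ.E j v)) = 0 :=
  LinearMap.congr_fun (Φ.EAsE_zero i j h) v

lemma E_Astar_E_apply_ne_zero {i j : Fin (d + 1)} (h : (i : ℕ) = j + 1) {v : V}
    (hv : Φ.E j v ≠ 0) : Φ.E i (Φ.Astar (Φ.E j v)) ≠ 0 := by
  obtain ⟨b, hb⟩ := exists_basis_of_orthogonal_idempotents Φ.finrank_eq Φ.E_mul Φ.E_ne
  intro h0
  refine Φ.EAsE_ne i j h (LinearMap.ext fun w => ?_)
  rw [hb j v] at h0 hv
  rw [map_smul, map_smul, smul_eq_zero_iff_right (left_ne_zero_of_smul hv)] at h0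
  simp [hb j w, h0]

/-- `Astar` has no nonzero eigenvector in a proper subspace `E_0 V + ⋯ + E_k V`. -/
lemma eq_zero_of_Astar_apply_eq_smul {v : V} {c : K} (hv : Φ.Astar v = c • v)
    (hlast : Φ.E (Fin.last d) v = 0) : v = 0 := by
  suffices h : ∀ n : ℕ, ∀ i : Fin (d + 1), d - n ≤ i → Φ.E i v = 0 by
    rw [← Φ.sum_E_apply v]
    exact Finset.sum_eq_zero fun i _ => h d i (by omega)
  intro n
  induction n with
  | zero =>
    intro i hi
    rwa [show i = Fin.last d from Fin.ext (by simp; omega)]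
  | succ n ih =>
    intro i hi
    by_cases hin : d - n ≤ i
    · exact ih i hin
    by_contra hne
    have hlt : (i : ℕ) + 1 < d + 1 := by omega
    refine Φ.E_Astar_E_apply_ne_zero (i := ⟨i + 1, hlt⟩) rfl hne ?_
    have h0 : Φ.E ⟨i + 1, hlt⟩ (Φ.Astar v) = 0 := by
      rw [hv, map_smul, ih ⟨i + 1, hlt⟩ (by simp; omega), smul_zero]
    rw [← Φ.sum_E_apply v, map_sum, map_sum, Finset.sum_eq_single i] at h0
    · exact h0
    · intro j _ hj
      have hji : (j : ℕ) ≠ i := fun h => hj (Fin.ext h)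
      rcases lt_or_gt_of_ne hji with h | h
      · exact Φ.E_Astar_E_apply_eq_zero (by simp; omega) v
      · rw [ih j (by omega), map_zero, map_zero]
    · simp

lemma Astar_sub_apply_mem_splitU {i j : Fin (d + 1)} (hij : (i : ℕ) = j + 1) {u : V}
    (hu : u ∈ splitU Φ i) :
    (Φ.Astar - Φ.θs i • (1 : Module.End K V)) u ∈ splitU Φ j := by
  rw [mem_splitU_iff] at hu ⊢
  obtain ⟨hu₁, hu₂⟩ := hu
  simp only [LinearMap.sub_apply, LinearMap.smul_apply, Module.End.one_apply, map_sub, map_smul]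
  refine ⟨fun h hh => ?_, fun h hh => ?_⟩
  · rw [Φ.Estar_Astar_apply]
    rcases eq_or_ne h i with rfl | hne
    · exact sub_self _
    · have : (h : ℕ) ≠ i := fun e => hne (Fin.ext e)
      simp [hu₁ h (by omega)]
  · rw [hu₂ h (by omega), smul_zero, sub_zero]
    conv_lhs => rw [← Φ.sum_E_apply u, map_sum, map_sum]
    refine Finset.sum_eq_zero fun k _ => ?_
    by_cases hk : d - (i : ℕ) < k
    · rw [hu₂ k hk, map_zero, map_zero]
    · exact Φ.E_Astar_E_apply_eq_zero (by omega) u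

lemma eq_zero_of_Astar_sub_apply_eq_zero {i : Fin (d + 1)} (hi : 1 ≤ (i : ℕ)) {u : V}
    (hu : u ∈ splitU Φ i) (h : (Φ.Astar - Φ.θs i • (1 : Module.End K V)) u = 0) : u = 0 := by
  rw [mem_splitU_iff] at hu
  refine Φ.eq_zero_of_Astar_apply_eq_smul (c := Φ.θs i) ?_
    (hu.2 (Fin.last d) (by rw [Fin.val_last]; omega))
  simpa [sub_eq_zero] using h

lemma exists_smul_eq_of_mem_splitU (i : Fin (d + 1)) {u v : V} (hu : u ∈ splitU Φ i)
    (hv : v ∈ splitU Φ i) (hne : u ≠ 0) : ∃ c : K, v = c • u := by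
  obtain ⟨n, hn⟩ := i
  induction n generalizing u v with
  | zero =>
    obtain ⟨b, hb⟩ := exists_basis_of_orthogonal_idempotents Φ.finrank_eq Φ.Es_mul Φ.Es_ne
    have key : ∀ w ∈ splitU Φ ⟨0, hn⟩, w = b.repr w 0 • b 0 := by
      intro w hw
      rw [mem_splitU_iff] at hw
      conv_lhs => rw [← Φ.sum_Estar_apply w]
      rw [Finset.sum_eq_single 0, hb]
      · exact fun j _ hj => hw.1 j (Fin.pos_iff_ne_zero.mpr hj)
      · simp
    rw [key u hu] at hne
    refine ⟨b.repr v 0 / b.repr u 0, ?_⟩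
    calc v = b.repr v 0 • b 0 := key v hv
      _ = (b.repr v 0 / b.repr u 0) • b.repr u 0 • b 0 := by
        rw [smul_smul, div_mul_cancel₀ _ (left_ne_zero_of_smul hne)]
      _ = (b.repr v 0 / b.repr u 0) • u := by rw [← key u hu]
  | succ n ih =>
    have hpos : 1 ≤ ((⟨n + 1, hn⟩ : Fin (d + 1)) : ℕ) := by simp
    have hmem := fun {w : V} (hw : w ∈ splitU Φ ⟨n + 1, hn⟩) =>
      Φ.Astar_sub_apply_mem_splitU (j := ⟨n, by omega⟩) rfl hw
    obtain ⟨c, hc⟩ := ih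
      (fun h => hne (Φ.eq_zero_of_Astar_sub_apply_eq_zero hpos hu h)) (by omega)
      (hmem hu) (hmem hv)
    refine ⟨c, sub_eq_zero.mp (Φ.eq_zero_of_Astar_sub_apply_eq_zero hpos
      (Submodule.sub_mem _ hv (Submodule.smul_mem _ c hu)) ?_)⟩
    rw [map_sub, map_smul, hc, sub_self]

lemma exists_mem_splitU_ne_zero (i : Fin (d + 1)) : ∃ u ∈ splitU Φ i, u ≠ 0 := by
  obtain ⟨b, hb⟩ := exists_basis_of_orthogonal_idempotents Φ.finrank_eq Φ.E_mul Φ.E_ne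
  obtain ⟨bs, hbs⟩ := exists_basis_of_orthogonal_idempotents Φ.finrank_eq Φ.Es_mul Φ.Es_ne
  have : FiniteDimensional K V := b.finiteDimensional_of_finite
  let f : V →ₗ[K] (Fin d → K) := LinearMap.pi fun t =>
    if h : (t : ℕ) < i then b.coord ⟨d - i + 1 + t, by omega⟩ else bs.coord t.succ
  obtain ⟨u, hu, hne⟩ := (Submodule.ne_bot_iff _).mp
    (LinearMap.ker_ne_bot_of_finrank_lt (f := f) (by simp [Φ.finrank_eq]))
  have hf : ∀ t, f u t = 0 := fun t => by rw [LinearMap.mem_ker.mp hu, Pi.zero_apply]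
  refine ⟨u, (Φ.mem_splitU_iff i u).mpr ⟨fun h hh => ?_, fun h hh => ?_⟩, hne⟩
  · have ht := hf ⟨h - 1, by omega⟩
    have he : Fin.succ (⟨h - 1, by omega⟩ : Fin d) = h := Fin.ext (by simp; omega)
    have hlt : ¬ (h : ℕ) - 1 < i := by omega
    simp only [f, LinearMap.pi_apply, hlt, dif_neg, not_false_eq_true, he,
      Module.Basis.coord_apply] at ht
    rw [hbs, ht, zero_smul]
  · have ht := hf ⟨h - (d - i + 1), by omega⟩
    have hlt : (h : ℕ) - (d - i + 1) < i := by omega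
    have he : (⟨d - i + 1 + (h - (d - i + 1)), by omega⟩ : Fin (d + 1)) = h :=
      Fin.ext (by simp; omega)
    simp only [f, LinearMap.pi_apply, hlt, dif_pos, he, Module.Basis.coord_apply] at ht
    rw [hb, ht, zero_smul]

/-- `Astar - θs i` maps `U_i` onto `U_{i-1}`. -/
lemma exists_mem_splitU_Astar_sub_apply_eq {i j : Fin (d + 1)} (hij : (i : ℕ) = j + 1) {u : V}
    (hu : u ∈ splitU Φ j) :
    ∃ w ∈ splitU Φ i, (Φ.Astar - Φ.θs i • (1 : Module.End K V)) w = u := by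
  obtain ⟨w, hw, hne⟩ := Φ.exists_mem_splitU_ne_zero i
  obtain ⟨c, hc⟩ := Φ.exists_smul_eq_of_mem_splitU j (Φ.Astar_sub_apply_mem_splitU hij hw) hu
    fun h => hne (Φ.eq_zero_of_Astar_sub_apply_eq_zero (by omega) hw h)
  exact ⟨c • w, Submodule.smul_mem _ c hw, by rw [map_smul, hc]⟩

end THSystem

/-- `φ_i` is also the eigenvalue of `(A* - θ*_i I)(A - θ_{d-i+1} I)` on `U_{i-1}`. -/
theorem splitSeq_reversed_product {K V : Type*} [Field K] [AddCommGroup V] [Module K V]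
    {d : ℕ} (Φ : THSystem K V d) (φ : Fin (d + 1) → K) (hφ : IsSplitSeq Φ φ) :
    ∀ i : Fin (d + 1), ∀ hi : 1 ≤ (i : ℕ),
      ∀ u ∈ splitU Φ ⟨(i : ℕ) - 1, by have := i.isLt; omega⟩,
        (Φ.Astar - Φ.θs i • (1 : Module.End K V))
          ((Φ.A - Φ.θ ⟨d - (i : ℕ) + 1, by have := i.isLt; omega⟩ • (1 : Module.End K V)) u)
        = φ i • u := by
  intro i hi u hu
  obtain ⟨w, hw, rfl⟩ := Φ.exists_mem_splitU_Astar_sub_apply_eq (i := i) (by simp; omega) hu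
  rw [hφ i hi w hw, map_smul]
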